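/- Let d ≥ 1, ħ > 0, σ > 0 and n ≥ 1 a natural number. With |z|, z ∧ z', the weighted norm ‖F‖_σ := ∫ e^{σ|s|}|F(s)| ds and the twisted convolution Mb_ħ(F,G)(s) := (2/ħ) ∫ F(s¹) G(s − s¹) sin(ħ (s ∧ s¹)/2) ds¹ defined as before on ℝ^{2d}, let F, G : ℝ^{2d} → ℂ be measurable with ‖F‖_σ < ∞, ‖G‖_σ < ∞, and define recursively H_0 := G and H_k := Mb_ħ(F, H_{k−1}) for k ≥ 1. Then ∫ e^{(σ/2)|s|} |H_n(s)| ds ≤ (4/σ²)^n · (n!)² · ‖F‖_σ^n · ‖G‖_σ. -/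

import Mathlib

open MeasureTheory
open scoped RealInnerProductSpace

/-- `|z| = ‖v‖ + ‖w‖` for `z = (v,w)`, with Euclidean norms on each factor. -/
noncomputable def phaseAbs {d : ℕ}
    (z : EuclideanSpace ℝ (Fin d) × EuclideanSpace ℝ (Fin d)) : ℝ :=
  ‖z.1‖ + ‖z.2‖

/-- The symplectic pairing `z ∧ z' = ⟨w, v'⟩ - ⟨v, w'⟩` for `z = (v,w)`, `z' = (v',w')`. -/
noncomputable def wedge {d : ℕ}
    (z z' : EuclideanSpace ℝ (Fin d) × EuclideanSpace ℝ (Fin d)) : ℝ :=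
  ⟪z.2, z'.1⟫ - ⟪z.1, z'.2⟫

/-- The twisted convolution arising as Fourier transform of the Moyal bracket:
`Mb_hbar(F,G)(s) = (2/hbar) ∫ F(s¹) G(s-s¹) sin(hbar (s ∧ s¹)/2) ds¹`. -/
noncomputable def moyalConv {d : ℕ} (hbar : ℝ)
    (F G : EuclideanSpace ℝ (Fin d) × EuclideanSpace ℝ (Fin d) → ℂ)
    (s : EuclideanSpace ℝ (Fin d) × EuclideanSpace ℝ (Fin d)) : ℂ :=
  (2 / hbar : ℝ) *
    ∫ s1, F s1 * G (s - s1) * ((Real.sin (hbar * wedge s s1 / 2) : ℝ) : ℂ)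

local notation "𝔼" d => EuclideanSpace ℝ (Fin d) × EuclideanSpace ℝ (Fin d)

theorem phaseAbs_nonneg {d : ℕ} (z : 𝔼 d) : 0 ≤ phaseAbs z :=
  add_nonneg (norm_nonneg _) (norm_nonneg _)

theorem phaseAbs_add_le {d : ℕ} (y z : 𝔼 d) : phaseAbs (y + z) ≤ phaseAbs y + phaseAbs z := by
  have h₁ := norm_add_le y.1 z.1
  have h₂ := norm_add_le y.2 z.2
  simp only [phaseAbs, Prod.fst_add, Prod.snd_add]
  linarith

theorem continuous_phaseAbs {d : ℕ} : Continuous (phaseAbs : (𝔼 d) → ℝ) := by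
  unfold phaseAbs
  fun_prop

theorem abs_wedge_le {d : ℕ} (y z : 𝔼 d) : |wedge y z| ≤ phaseAbs y * phaseAbs z := by
  have h₁ := abs_real_inner_le_norm y.2 z.1
  have h₂ := abs_real_inner_le_norm y.1 z.2
  have h₃ := abs_sub (⟪y.2, z.1⟫ : ℝ) ⟪y.1, z.2⟫
  have h₄ := mul_nonneg (norm_nonneg y.1) (norm_nonneg z.1)
  have h₅ := mul_nonneg (norm_nonneg y.2) (norm_nonneg z.2)
  simp only [phaseAbs, wedge]
  linarith

/-- The pairing is alternating, so the first argument may be translated by the second. -/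
theorem wedge_sub_self_left {d : ℕ} (y z : 𝔼 d) : wedge (y - z) z = wedge y z := by
  simp only [wedge, Prod.fst_sub, Prod.snd_sub, inner_sub_left, real_inner_comm z.1 z.2]
  ring

/-- An algebraic weight is absorbed by an exponential one at the cost `1 / (e δ)`. -/
theorem le_exp_mul_div {δ : ℝ} (hδ : 0 < δ) (t : ℝ) :
    t ≤ Real.exp (δ * t) / (Real.exp 1 * δ) := by
  have h := Real.add_one_le_exp (δ * t - 1)
  rw [Real.exp_sub, le_div_iff₀ (Real.exp_pos 1)] at h
  rw [le_div_iff₀ (by positivity)]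
  linarith

theorem two_div_mul_abs_sin_le {d : ℕ} {hbar : ℝ} (hhbar : 0 < hbar) (s t : 𝔼 d) :
    2 / hbar * |Real.sin (hbar * wedge s t / 2)| ≤ phaseAbs t * phaseAbs (s - t) := by
  calc 2 / hbar * |Real.sin (hbar * wedge s t / 2)|
      ≤ 2 / hbar * |hbar * wedge s t / 2| :=
        mul_le_mul_of_nonneg_left Real.abs_sin_le_abs (by positivity)
    _ = |wedge (s - t) t| := by
        rw [wedge_sub_self_left, abs_div, abs_mul, abs_of_pos hhbar, abs_two]
        field_simp
    _ ≤ phaseAbs t * phaseAbs (s - t) := by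
        rw [mul_comm (phaseAbs t)]
        exact abs_wedge_le _ _

/-- The kernel of the twisted convolution, weighted by `exp (τ |s|)`, is dominated by a product
of exponential weights with exponent `τ + δ`, uniformly in `hbar`. -/
theorem exp_mul_two_div_mul_abs_sin_le {d : ℕ} {hbar τ δ : ℝ} (hhbar : 0 < hbar) (hτ : 0 ≤ τ)
    (hδ : 0 < δ) (s t : 𝔼 d) :
    Real.exp (τ * phaseAbs s) * (2 / hbar * |Real.sin (hbar * wedge s t / 2)|) ≤
      (1 / (Real.exp 1 * δ)) ^ 2 *
        (Real.exp ((τ + δ) * phaseAbs t) * Real.exp ((τ + δ) * phaseAbs (s - t))) := by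
  have hexp : Real.exp (τ * phaseAbs s) ≤
      Real.exp (τ * phaseAbs t) * Real.exp (τ * phaseAbs (s - t)) := by
    rw [← Real.exp_add, ← mul_add]
    have h := phaseAbs_add_le t (s - t)
    rw [add_sub_cancel] at h
    gcongr
  have hpoly : phaseAbs t * phaseAbs (s - t) ≤ (Real.exp (δ * phaseAbs t) / (Real.exp 1 * δ)) *
      (Real.exp (δ * phaseAbs (s - t)) / (Real.exp 1 * δ)) :=
    mul_le_mul (le_exp_mul_div hδ _) (le_exp_mul_div hδ _) (phaseAbs_nonneg _) (by positivity)
  refine (mul_le_mul hexp ((two_div_mul_abs_sin_le hhbar s t).trans hpoly) (by positivity)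
    (by positivity)).trans_eq ?_
  simp only [add_mul, Real.exp_add]
  ring

/-- The weighted norm `∫ exp (τ |s|) ‖F s‖ ds`, with values in `[0, ∞]`. -/
noncomputable def weightedNorm {d : ℕ} (τ : ℝ) (F : (𝔼 d) → ℂ) : ENNReal :=
  ∫⁻ s, ENNReal.ofReal (Real.exp (τ * phaseAbs s) * ‖F s‖)

theorem weightedNorm_mono {d : ℕ} {τ τ' : ℝ} (h : τ ≤ τ') (F : (𝔼 d) → ℂ) :
    weightedNorm τ F ≤ weightedNorm τ' F := by
  refine lintegral_mono fun s => ENNReal.ofReal_le_ofReal ?_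
  have := phaseAbs_nonneg s
  gcongr

theorem measurable_moyalConv {d : ℕ} (hbar : ℝ) {F G : (𝔼 d) → ℂ} (hF : Measurable F)
    (hG : Measurable G) : Measurable (moyalConv hbar F G) := by
  have hwedge : Continuous fun p : (𝔼 d) × (𝔼 d) => wedge p.1 p.2 := by
    unfold wedge
    fun_prop
  have hmeas : Measurable fun p : (𝔼 d) × (𝔼 d) =>
      F p.2 * G (p.1 - p.2) * ((Real.sin (hbar * wedge p.1 p.2 / 2) : ℝ) : ℂ) :=
    ((hF.comp measurable_snd).mul (hG.comp (measurable_fst.sub measurable_snd))).mul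
      (by fun_prop : Continuous fun p : (𝔼 d) × (𝔼 d) =>
        ((Real.sin (hbar * wedge p.1 p.2 / 2) : ℝ) : ℂ)).measurable
  exact (hmeas.stronglyMeasurable.integral_prod_right.measurable).const_mul _

theorem lintegral_lintegral_mul_sub {E : Type*} [AddGroup E] [MeasurableSpace E]
    [MeasurableAdd₂ E] [MeasurableSub₂ E] {μ : Measure E} [SFinite μ] [μ.IsAddRightInvariant]
    {f g : E → ENNReal} (hf : Measurable f) (hg : Measurable g) :
    ∫⁻ s, ∫⁻ t, f t * g (s - t) ∂μ ∂μ = (∫⁻ t, f t ∂μ) * ∫⁻ t, g t ∂μ := by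
  have hmeas : Measurable fun p : E × E => f p.2 * g (p.1 - p.2) :=
    (hf.comp measurable_snd).mul (hg.comp (measurable_fst.sub measurable_snd))
  rw [lintegral_lintegral_swap hmeas.aemeasurable, ← lintegral_mul_const _ hf]
  refine lintegral_congr fun t => ?_
  rw [lintegral_const_mul _ (by fun_prop : Measurable fun s => g (s - t)),
    lintegral_sub_right_eq_self g t]

theorem ofReal_exp_mul_norm_moyalConv_le {d : ℕ} {hbar τ δ : ℝ} (hhbar : 0 < hbar) (hτ : 0 ≤ τ)
    (hδ : 0 < δ) (F G : (𝔼 d) → ℂ) (s : 𝔼 d) :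
    ENNReal.ofReal (Real.exp (τ * phaseAbs s) * ‖moyalConv hbar F G s‖) ≤
      ENNReal.ofReal ((1 / (Real.exp 1 * δ)) ^ 2) *
        ∫⁻ t, ENNReal.ofReal (Real.exp ((τ + δ) * phaseAbs t) * ‖F t‖) *
          ENNReal.ofReal (Real.exp ((τ + δ) * phaseAbs (s - t)) * ‖G (s - t)‖) := by
  have hc : (0 : ℝ) ≤ 2 / hbar := by positivity
  rw [moyalConv, norm_mul, Complex.norm_real, Real.norm_of_nonneg hc, ← mul_assoc,
    ENNReal.ofReal_mul (by positivity), ofReal_norm]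
  grw [enorm_integral_le_lintegral_enorm]
  rw [← lintegral_const_mul' _ _ ENNReal.ofReal_ne_top,
    ← lintegral_const_mul' _ _ ENNReal.ofReal_ne_top]
  refine lintegral_mono fun t => ?_
  dsimp only
  rw [← ofReal_norm, ← ENNReal.ofReal_mul (by positivity), ← ENNReal.ofReal_mul (by positivity),
    ← ENNReal.ofReal_mul (by positivity)]
  refine ENNReal.ofReal_le_ofReal ?_
  have h := mul_le_mul_of_nonneg_right (exp_mul_two_div_mul_abs_sin_le hhbar hτ hδ s t)
    (mul_nonneg (norm_nonneg (F t)) (norm_nonneg (G (s - t))))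
  rw [norm_mul, norm_mul, Complex.norm_real, Real.norm_eq_abs]
  linarith

theorem weightedNorm_moyalConv_le {d : ℕ} {hbar τ δ : ℝ} (hhbar : 0 < hbar) (hτ : 0 ≤ τ)
    (hδ : 0 < δ) {F G : (𝔼 d) → ℂ} (hF : Measurable F) (hG : Measurable G) :
    weightedNorm τ (moyalConv hbar F G) ≤ ENNReal.ofReal ((1 / (Real.exp 1 * δ)) ^ 2) *
      (weightedNorm (τ + δ) F * weightedNorm (τ + δ) G) := by
  have hweight {K : (𝔼 d) → ℂ} (hK : Measurable K) :
      Measurable fun s => ENNReal.ofReal (Real.exp ((τ + δ) * phaseAbs s) * ‖K s‖) :=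
    ((Real.measurable_exp.comp (continuous_phaseAbs.measurable.const_mul _)).mul
      hK.norm).ennreal_ofReal
  have : (volume : Measure (𝔼 d)).IsAddRightInvariant :=
    inferInstanceAs (Measure.prod volume volume).IsAddRightInvariant
  refine (lintegral_mono (ofReal_exp_mul_norm_moyalConv_le hhbar hτ hδ F G)).trans_eq ?_
  rw [lintegral_const_mul' _ _ ENNReal.ofReal_ne_top,
    lintegral_lintegral_mul_sub (hweight hF) (hweight hG)]
  rfl

/-- Iterating the one-step estimate with loss `δ` per step. -/
theorem weightedNorm_iterate_le {d : ℕ} {hbar σ δ : ℝ} (hhbar : 0 < hbar) (hδ : 0 < δ)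
    {F G : (𝔼 d) → ℂ} (hF : Measurable F) (hG : Measurable G) {H : ℕ → (𝔼 d) → ℂ}
    (hH0 : H 0 = G) (hHrec : ∀ k, H (k + 1) = moyalConv hbar F (H k)) (k : ℕ)
    (hk : k * δ ≤ σ) :
    weightedNorm (σ - k * δ) (H k) ≤
      (ENNReal.ofReal ((1 / (Real.exp 1 * δ)) ^ 2) * weightedNorm σ F) ^ k *
        weightedNorm σ G := by
  have hmeas (j : ℕ) : Measurable (H j) := by
    induction j with
    | zero => rwa [hH0]
    | succ j ih => rw [hHrec]; exact measurable_moyalConv hbar hF ih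
  induction k with
  | zero => simp [hH0]
  | succ k ih =>
    push_cast at hk ⊢
    have hkδ : 0 ≤ k * δ := by positivity
    have hstep := weightedNorm_moyalConv_le hhbar (sub_nonneg.2 hk) hδ hF (hmeas k)
    rw [show σ - (k + 1) * δ + δ = σ - k * δ by ring] at hstep
    rw [hHrec]
    grw [hstep, ih (by linarith), weightedNorm_mono (sub_le_self σ hkδ) F]
    exact le_of_eq (by ring)

theorem pow_self_le_exp_mul_factorial (n : ℕ) :
    (n : ℝ) ^ n ≤ Real.exp 1 ^ n * n.factorial := by
  have h := Real.pow_div_factorial_le_exp (n : ℝ) n.cast_nonneg n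
  rwa [div_le_iff₀ (by positivity), ← mul_one (n : ℝ), Real.exp_nat_mul, mul_one] at h

theorem one_div_exp_mul_sq_pow_le {σ : ℝ} (hσ : 0 < σ) {n : ℕ} (hn : 1 ≤ n) :
    ((1 / (Real.exp 1 * (σ / (2 * n)))) ^ 2) ^ n ≤
      (4 / σ ^ 2) ^ n * (n.factorial : ℝ) ^ 2 := by
  have hn' : (0 : ℝ) < n := by exact_mod_cast hn
  have hfac : (n : ℝ) ^ n / Real.exp 1 ^ n ≤ n.factorial := by
    rw [div_le_iff₀ (by positivity), mul_comm]
    exact pow_self_le_exp_mul_factorial n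
  calc ((1 / (Real.exp 1 * (σ / (2 * n)))) ^ 2) ^ n
      = (4 / σ ^ 2) ^ n * ((n : ℝ) ^ n / Real.exp 1 ^ n) ^ 2 := by
        rw [← div_pow, ← pow_mul _ n 2, mul_comm n 2, pow_mul _ 2 n, ← mul_pow]
        congr 1
        field_simp
        norm_num
    _ ≤ (4 / σ ^ 2) ^ n * (n.factorial : ℝ) ^ 2 := by gcongr

theorem weightedNorm_eq_ofReal_integral {d : ℕ} {σ : ℝ} {F : (𝔼 d) → ℂ}
    (hF : Integrable (fun s => Real.exp (σ * phaseAbs s) * ‖F s‖) volume) :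
    weightedNorm σ F = ENNReal.ofReal (∫ s, Real.exp (σ * phaseAbs s) * ‖F s‖) :=
  (ofReal_integral_eq_lintegral_ofReal hF
    (Filter.Eventually.of_forall fun _ => by positivity)).symm

/-- Choosing the loss `δ = σ/(2n)` per step in the iterated Moyal bracket estimate
yields the `hbar`-independent bound `‖H_n‖_{σ/2} ≤ (4/σ²)ⁿ (n!)² ‖F‖_σⁿ ‖G‖_σ`. -/
theorem iterated_moyal_bracket_factorial_estimate (d : ℕ) (hd : 1 ≤ d)
    (hbar σ : ℝ) (n : ℕ) (hhbar : 0 < hbar) (hσ : 0 < σ) (hn : 1 ≤ n)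
    (F G : EuclideanSpace ℝ (Fin d) × EuclideanSpace ℝ (Fin d) → ℂ)
    (hF : Measurable F) (hG : Measurable G)
    (hFσ : Integrable (fun s => Real.exp (σ * phaseAbs s) * ‖F s‖) volume)
    (hGσ : Integrable (fun s => Real.exp (σ * phaseAbs s) * ‖G s‖) volume)
    (H : ℕ → EuclideanSpace ℝ (Fin d) × EuclideanSpace ℝ (Fin d) → ℂ)
    (hH0 : H 0 = G) (hHrec : ∀ k : ℕ, H (k + 1) = moyalConv hbar F (H k)) :
    (∫⁻ s, ENNReal.ofReal
        (Real.exp ((σ / 2) * phaseAbs s) * ‖H n s‖) ∂volume) ≤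
      ENNReal.ofReal ((4 / σ ^ 2) ^ n * (n.factorial : ℝ) ^ 2 *
        (∫ s, Real.exp (σ * phaseAbs s) * ‖F s‖) ^ n *
        (∫ s, Real.exp (σ * phaseAbs s) * ‖G s‖)) := by
  have hn' : (n : ℝ) ≠ 0 := by positivity
  have hnδ : n * (σ / (2 * n)) = σ / 2 := by field_simp
  have h := weightedNorm_iterate_le (σ := σ) (δ := σ / (2 * n)) hhbar (by positivity) hF hG hH0
    hHrec n (by linarith)
  rw [hnδ, sub_half, weightedNorm_eq_ofReal_integral hFσ, weightedNorm_eq_ofReal_integral hGσ,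
    ← ENNReal.ofReal_mul (by positivity), ← ENNReal.ofReal_pow (by positivity),
    ← ENNReal.ofReal_mul (by positivity), mul_pow] at h
  refine h.trans (ENNReal.ofReal_le_ofReal ?_)
  gcongr ?_ * _ * _
  exact one_div_exp_mul_sq_pow_le hσ hn
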